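/- arXiv:2107.10832 — 2 statements merged into one kernel-verified Lean document; each statement's English description precedes it below -/
import Mathlib

section
/- For every formula φ of the language 𝓛, the formula ¬Eφ ↔ ¬A¬(Sφ ∧ ¬φ) is valid, and likewise ¬Eφ ↔ ¬A¬(φ ∧ S¬φ) is valid: a source lacks expertise on φ iff at some state φ is sound but false, iff at some state φ is true but ¬φ is sound. -/
/-- The language 𝓛: propositional variables (indexed by ℕ, hence countable),
negation, conjunction, and modalities E (expertise), S (soundness), A (universal). -/
inductive Form : Type where
  | var : ℕ → Form
  | neg : Form → Form
  | and : Form → Form → Form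
  | E : Form → Form
  | S : Form → Form
  | A : Form → Form

/-- Material implication, as the usual Boolean abbreviation. -/
def Form.imp (φ ψ : Form) : Form := .neg (.and φ (.neg ψ))

/-- Biconditional, as the usual Boolean abbreviation. -/
def Form.iff (φ ψ : Form) : Form := .and (φ.imp ψ) (ψ.imp φ)

/-- An expertise model on a set of states `X`: an expertise set `P`
(containing `X`, closed under complements and arbitrary intersections)
together with a valuation `v`. -/
structure ExpModel (X : Type*) where
  P : Set (Set X)
  univ_mem : Set.univ ∈ P
  compl_mem : ∀ A ∈ P, Aᶜ ∈ P
  sInter_mem : ∀ Q ⊆ P, ⋂₀ Q ∈ P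
  v : ℕ → Set X

/-- The truth set `‖φ‖_M` of a formula in an expertise model. -/
def truthSet {X : Type*} (M : ExpModel X) : Form → Set X
  | .var p => M.v p
  | .neg φ => (truthSet M φ)ᶜ
  | .and φ ψ => truthSet M φ ∩ truthSet M ψ
  | .E φ => {_x | truthSet M φ ∈ M.P}
  | .S φ => {x | ∀ A ∈ M.P, truthSet M φ ⊆ A → x ∈ A}
  | .A φ => {_x | ∀ y, y ∈ truthSet M φ}

/-- Satisfaction: `M, x ⊨ φ`. -/
def Sat {X : Type*} (M : ExpModel X) (x : X) (φ : Form) : Prop :=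
  x ∈ truthSet M φ

/-- Validity: `φ` is true at every state of every expertise model. -/
def Valid (φ : Form) : Prop :=
  ∀ (X : Type*) (M : ExpModel X) (x : X), Sat M x φ

theorem sat_iff {X : Type*} (M : ExpModel X) (x : X) (φ ψ : Form) :
    Sat M x (φ.iff ψ) ↔ (Sat M x φ ↔ Sat M x ψ) := by
  simp only [Sat, Form.iff, Form.imp, truthSet, Set.mem_inter_iff, Set.mem_compl_iff]
  tauto

theorem sat_neg_A_neg {X : Type*} (M : ExpModel X) (x : X) (φ : Form) :
    Sat M x (.neg (.A (.neg φ))) ↔ ∃ y, Sat M y φ := by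
  simp [Sat, truthSet]

theorem truthSet_S {X : Type*} (M : ExpModel X) (φ : Form) :
    truthSet M (.S φ) = ⋂₀ {A | A ∈ M.P ∧ truthSet M φ ⊆ A} := by
  ext x
  simp [truthSet]

/-- A formula has expertise iff its soundness closure adds no states. -/
theorem truthSet_mem_P_iff {X : Type*} (M : ExpModel X) (φ : Form) :
    truthSet M φ ∈ M.P ↔ truthSet M (.S φ) ⊆ truthSet M φ := by
  constructor
  · intro h x hx
    exact hx _ h subset_rfl
  · intro h
    have hS : truthSet M φ = truthSet M (.S φ) :=
      Set.Subset.antisymm (fun _ hx _ _ hA => hA hx) h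
    rw [hS, truthSet_S]
    exact M.sInter_mem _ fun _ hA => hA.1

theorem truthSet_neg_mem_P_iff {X : Type*} (M : ExpModel X) (φ : Form) :
    truthSet M (.neg φ) ∈ M.P ↔ truthSet M φ ∈ M.P := by
  refine ⟨fun h => ?_, M.compl_mem _⟩
  simpa [truthSet] using M.compl_mem _ h

/-- Lack of expertise: ¬Eφ ↔ ¬A¬(Sφ ∧ ¬φ) and ¬Eφ ↔ ¬A¬(φ ∧ S¬φ) are valid. -/
theorem valid_not_E_characterisations (φ : Form) :
    Valid ((Form.neg (.E φ)).iff (.neg (.A (.neg (.and (.S φ) (.neg φ)))))) ∧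
    Valid ((Form.neg (.E φ)).iff (.neg (.A (.neg (.and φ (.S (.neg φ))))))) := by
  refine ⟨fun X M x => ?_, fun X M x => ?_⟩ <;> rw [sat_iff, sat_neg_A_neg]
  · change truthSet M φ ∉ M.P ↔ _
    rw [truthSet_mem_P_iff, Set.not_subset]
    rfl
  · change truthSet M φ ∉ M.P ↔ _
    rw [← truthSet_neg_mem_P_iff, truthSet_mem_P_iff, Set.not_subset]
    simp [Sat, truthSet, and_comm]
end

section
/- The axiom 5_S is valid in all expertise frames: for every formula φ of 𝓛, every expertise model M, and every state x, if M,x ⊨ S¬Sφ then M,x ⊨ ¬Sφ. -/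
/-- The truth set of `S φ` belongs to the expertise set. -/
lemma truthSet_S_mem {X : Type*} (M : ExpModel X) (φ : Form) :
    truthSet M (.S φ) ∈ M.P := by
  have h_eq : truthSet M (.S φ) = ⋂₀ {A ∈ M.P | truthSet M φ ⊆ A} := by
    ext x
    simp [truthSet]
  rw [h_eq]
  exact M.sInter_mem _ (Set.sep_subset _ _)

/-- Axiom 5_S is valid in all expertise frames: if M, x ⊨ S¬Sφ then M, x ⊨ ¬Sφ. -/
theorem valid_5S (φ : Form) {X : Type*} (M : ExpModel X) (x : X)
    (h : Sat M x (.S (.neg (.S φ)))) :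
    Sat M x (.neg (.S φ)) :=
  h _ (M.compl_mem _ (truthSet_S_mem M φ)) subset_rfl
end
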